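/- arXiv:1305.7242 — 2 statements merged into one kernel-verified Lean document; each statement's English description precedes it below -/
import Mathlib

section
/- Let 0 < p0 < p1 < 1 and let r* = r*(p0,p1) = log((1−p0)/(1−p1)) / log( (p1/p0)·((1−p0)/(1−p1)) ). Suppose M_N is a sequence of integers with 1 ≤ M_N ≤ N, M_N/N → r* as N → ∞, and lim_{N→∞} ( (p0(1−p1))/(p1(1−p0)) )^{M_N − N r*} = α for some α ∈ [0,∞]. Then lim_{N→∞} s(N,M_N;p0,p1) = [ (2p0−1)(1−p1) + (2p1−1)(1−p0)α ] / [ (1−p1) + (1−p0)α ], this limit being interpreted as 2p1 − 1 when α = ∞. -/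
open Filter Finset Topology
open scoped ENNReal

/-- The explicit speed formula `s(N,M;p₀,p₁)`. -/
noncomputable def speed1 (N M : ℕ) (p0 p1 : ℝ) : ℝ :=
  ((1 / (1 - p0)) * ∑ j ∈ Finset.range M,
      (2 * (j : ℝ) / N - 1) * (N.choose j) * (p0 / (1 - p0)) ^ j
    + (1 / (1 - p1)) * (p0 / (1 - p0)) ^ M * ∑ j ∈ Finset.Icc M N,
      (2 * (j : ℝ) / N - 1) * (N.choose j) * (p1 / (1 - p1)) ^ (j - M)) /
  ((1 / (1 - p0)) * ∑ j ∈ Finset.range M,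
      ((N.choose j : ℝ)) * (p0 / (1 - p0)) ^ j
    + (1 / (1 - p1)) * (p0 / (1 - p0)) ^ M * ∑ j ∈ Finset.Icc M N,
      ((N.choose j : ℝ)) * (p1 / (1 - p1)) ^ (j - M))

/-- The critical threshold fraction `r*(p₀,p₁)`. -/
noncomputable def rstar (p0 p1 : ℝ) : ℝ :=
  Real.log ((1 - p0) / (1 - p1)) / Real.log ((p1 / p0) * ((1 - p0) / (1 - p1)))

/-- The mass at `j` of the binomial distribution with parameters `N` and `p`. -/
noncomputable def binomialMass (p : ℝ) (N j : ℕ) : ℝ :=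
  N.choose j * p ^ j * (1 - p) ^ (N - j)

lemma binomialMass_nonneg {p : ℝ} (hp : 0 ≤ p) (hp' : p ≤ 1) (N j : ℕ) :
    0 ≤ binomialMass p N j := by
  have : 0 ≤ 1 - p := by linarith
  unfold binomialMass
  positivity

lemma sum_binomialMass (p : ℝ) (N : ℕ) :
    ∑ j ∈ range (N + 1), binomialMass p N j = 1 := by
  have h := congrArg (Polynomial.eval p) (bernsteinPolynomial.sum ℝ N)
  simpa [Polynomial.eval_finsetSum, bernsteinPolynomial, binomialMass] using h

lemma sum_sq_mul_binomialMass (p : ℝ) {N : ℕ} (hN : 1 ≤ N) :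
    ∑ j ∈ range (N + 1), ((j : ℝ) / N - p) ^ 2 * binomialMass p N j = p * (1 - p) / N := by
  have hN0 : (N : ℝ) ≠ 0 := by positivity
  have h := congrArg (Polynomial.eval p) (bernsteinPolynomial.variance ℝ N)
  simp only [Polynomial.eval_finsetSum, bernsteinPolynomial, nsmul_eq_mul, Polynomial.eval_mul,
    Polynomial.eval_pow, Polynomial.eval_sub, Polynomial.eval_natCast, Polynomial.eval_X,
    Polynomial.eval_one] at h
  have h' : ∑ j ∈ range (N + 1), ((j : ℝ) / N - p) ^ 2 * binomialMass p N j
      = (1 / (N : ℝ) ^ 2) * (N * p * (1 - p)) := by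
    rw [← h, mul_sum]
    refine sum_congr rfl fun j _ => ?_
    unfold binomialMass
    field_simp
    ring
  rw [h']
  field_simp

/-- A weak law of large numbers for binomial averages of functions that are close to `L`
up to a quadratic error around `p`. -/
lemma tendsto_sum_mul_binomialMass {p : ℝ} (hp : 0 ≤ p) (hp' : p ≤ 1) (g : ℕ → ℕ → ℝ) (L : ℝ)
    (hg : ∀ ε > 0, ∃ C : ℝ, ∀ᶠ N : ℕ in atTop, ∀ j ≤ N,
      |g N j - L| ≤ ε + C * ((j : ℝ) / N - p) ^ 2) :
    Tendsto (fun N => ∑ j ∈ range (N + 1), g N j * binomialMass p N j) atTop (𝓝 L) := by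
  rw [Metric.tendsto_atTop']
  intro ε hε
  obtain ⟨C, hC⟩ := hg (ε / 2) (by positivity)
  have hlim : Tendsto (fun N : ℕ => C * (p * (1 - p)) / (N : ℝ)) atTop (𝓝 0) :=
    tendsto_const_div_atTop_nhds_zero_nat _
  have hev := hC.and ((hlim.eventually_lt_const (half_pos hε)).and (eventually_ge_atTop 1))
  obtain ⟨N₀, hN₀⟩ := eventually_atTop.1 hev
  refine ⟨N₀, fun N hN => ?_⟩
  obtain ⟨hb, hsmall, hN1⟩ := hN₀ N hN.le
  have hdiff : ∑ j ∈ range (N + 1), g N j * binomialMass p N j - L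
      = ∑ j ∈ range (N + 1), (g N j - L) * binomialMass p N j := by
    simp only [sub_mul, sum_sub_distrib, ← mul_sum, sum_binomialMass, mul_one]
  rw [Real.dist_eq, hdiff]
  calc |∑ j ∈ range (N + 1), (g N j - L) * binomialMass p N j|
      ≤ ∑ j ∈ range (N + 1), |(g N j - L) * binomialMass p N j| := abs_sum_le_sum_abs _ _
    _ ≤ ∑ j ∈ range (N + 1),
          (ε / 2 + C * ((j : ℝ) / N - p) ^ 2) * binomialMass p N j := by
        refine sum_le_sum fun j hj => ?_
        have hm := binomialMass_nonneg hp hp' N j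
        rw [abs_mul, abs_of_nonneg hm]
        exact mul_le_mul_of_nonneg_right (hb j (by simpa [Nat.lt_succ_iff] using hj)) hm
    _ = ε / 2 + C * (p * (1 - p)) / N := by
        simp only [add_mul, sum_add_distrib, mul_assoc, ← mul_sum, sum_binomialMass,
          sum_sq_mul_binomialMass p hN1]
        ring
    _ < ε := by linarith

/-- Binomial averages of an affine function restricted to sets containing a macroscopic
neighbourhood of the mean converge to the value at the mean. -/
lemma tendsto_sum_ite_mul_binomialMass {p : ℝ} (hp : 0 ≤ p) (hp' : p ≤ 1)
    (S : ℕ → ℕ → Prop) [∀ N j, Decidable (S N j)] (c d : ℝ) {δ : ℝ} (hδ : 0 < δ)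
    (hS : ∀ᶠ N : ℕ in atTop, ∀ j, ¬ S N j → δ ≤ |(j : ℝ) / N - p|) :
    Tendsto (fun N => ∑ j ∈ range (N + 1),
      (if S N j then d * ((j : ℝ) / N) + c else 0) * binomialMass p N j) atTop
      (𝓝 (d * p + c)) := by
  refine tendsto_sum_mul_binomialMass hp hp' _ _ fun ε hε => ?_
  refine ⟨d ^ 2 / (4 * ε) + |d * p + c| / δ ^ 2, ?_⟩
  filter_upwards [hS] with N hN j _
  set x : ℝ := (j : ℝ) / N - p with hx
  have hA : 0 ≤ d ^ 2 / (4 * ε) * x ^ 2 := by positivity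
  have hB : 0 ≤ |d * p + c| / δ ^ 2 * x ^ 2 := by positivity
  rw [add_mul]
  split_ifs with h
  · have e1 : d * ((j : ℝ) / N) + c - (d * p + c) = d * x := by rw [hx]; ring
    have e2 : ε + d ^ 2 / (4 * ε) * x ^ 2 - |d * x| = (2 * ε - |d * x|) ^ 2 / (4 * ε) := by
      have := sq_abs (d * x)
      field_simp
      linear_combination -this
    have : 0 ≤ (2 * ε - |d * x|) ^ 2 / (4 * ε) := by positivity
    rw [e1]
    linarith
  · have h2 : δ ^ 2 ≤ x ^ 2 := by
      rw [← sq_abs x]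
      exact pow_le_pow_left₀ hδ.le (hN j h) 2
    have h3 : |d * p + c| ≤ |d * p + c| / δ ^ 2 * x ^ 2 := by
      rw [div_mul_eq_mul_div, le_div_iff₀ (by positivity)]
      exact mul_le_mul_of_nonneg_left h2 (abs_nonneg _)
    rw [zero_sub, abs_neg]
    linarith

lemma log_mul_div_pos {p0 p1 : ℝ} (h0 : 0 < p0) (h01 : p0 < p1) (h1 : p1 < 1) :
    0 < Real.log ((p1 / p0) * ((1 - p0) / (1 - p1))) := by
  apply Real.log_pos
  have a : 1 < p1 / p0 := by rwa [one_lt_div h0]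
  have b : 1 < (1 - p0) / (1 - p1) := by rw [one_lt_div] <;> linarith
  exact one_lt_mul_of_lt_of_le a b.le

/-- Gibbs' inequality for two Bernoulli distributions. -/
lemma bernoulli_klDiv_pos {p q : ℝ} (hp : 0 < p) (hp' : p < 1) (hq : 0 < q) (hq' : q < 1)
    (hpq : p ≠ q) :
    0 < p * (Real.log p - Real.log q) + (1 - p) * (Real.log (1 - p) - Real.log (1 - q)) := by
  have hp1 : 0 < 1 - p := by linarith
  have hq1 : 0 < 1 - q := by linarith
  have a := Real.log_lt_sub_one_of_pos (div_pos hq hp) (by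
    rw [Ne, div_eq_one_iff_eq hp.ne']; exact hpq.symm)
  have b := Real.log_le_sub_one_of_pos (div_pos hq1 hp1)
  rw [Real.log_div hq.ne' hp.ne'] at a
  rw [Real.log_div hq1.ne' hp1.ne'] at b
  have a' := mul_lt_mul_of_pos_left a hp
  have b' := mul_le_mul_of_nonneg_left b hp1.le
  have e1 : p * (q / p - 1) = q - p := by field_simp
  have e2 : (1 - p) * ((1 - q) / (1 - p) - 1) = p - q := by field_simp; ring
  rw [e1] at a'
  rw [e2] at b'
  linarith

lemma rstar_mem_Ioo {p0 p1 : ℝ} (h0 : 0 < p0) (h01 : p0 < p1) (h1 : p1 < 1) :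
    rstar p0 p1 ∈ Set.Ioo p0 p1 := by
  have hp1 : 0 < p1 := h0.trans h01
  have hq0 : 0 < 1 - p0 := by linarith
  have hq1 : 0 < 1 - p1 := by linarith
  have hlog := log_mul_div_pos h0 h01 h1
  have k0 := bernoulli_klDiv_pos h0 (h01.trans h1) hp1 h1 h01.ne
  have k1 := bernoulli_klDiv_pos hp1 h1 h0 (h01.trans h1) h01.ne'
  have e : Real.log ((p1 / p0) * ((1 - p0) / (1 - p1)))
      = Real.log p1 - Real.log p0 + (Real.log (1 - p0) - Real.log (1 - p1)) := by
    rw [Real.log_mul (by positivity) (by positivity), Real.log_div hp1.ne' h0.ne',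
      Real.log_div hq0.ne' hq1.ne']
  have e' := Real.log_div hq0.ne' hq1.ne'
  unfold rstar
  constructor
  · rw [lt_div_iff₀ hlog, e, e']
    linarith
  · rw [div_lt_iff₀ hlog, e, e']
    linarith

lemma rpow_sub_mul_rstar {p0 p1 : ℝ} (h0 : 0 < p0) (h01 : p0 < p1) (h1 : p1 < 1) (M N : ℕ) :
    ((p0 * (1 - p1)) / (p1 * (1 - p0))) ^ ((M : ℝ) - N * rstar p0 p1)
      = ((p0 * (1 - p1)) / (p1 * (1 - p0))) ^ M * ((1 - p0) / (1 - p1)) ^ N := by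
  have hp1 : 0 < p1 := h0.trans h01
  have hq0 : 0 < 1 - p0 := by linarith
  have hq1 : 0 < 1 - p1 := by linarith
  have hlog := log_mul_div_pos h0 h01 h1
  have hθ : 0 < (p0 * (1 - p1)) / (p1 * (1 - p0)) := by positivity
  have hinv : (p0 * (1 - p1)) / (p1 * (1 - p0)) = ((p1 / p0) * ((1 - p0) / (1 - p1)))⁻¹ := by
    field_simp
  rw [sub_eq_add_neg (M : ℝ), Real.rpow_add hθ, Real.rpow_natCast]
  congr 1
  rw [Real.rpow_def_of_pos hθ, ← Real.exp_log (show 0 < ((1 - p0) / (1 - p1)) ^ N by positivity),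
    Real.log_pow, hinv, Real.log_inv]
  congr 1
  unfold rstar
  generalize Real.log ((p1 / p0) * ((1 - p0) / (1 - p1))) = c at hlog ⊢
  field_simp

lemma pow_mul_div_pow {p : ℝ} (hp : p ≠ 1) {N j : ℕ} (hj : j ≤ N) :
    N.choose j * (p / (1 - p)) ^ j = ((1 - p) ^ N)⁻¹ * binomialMass p N j := by
  have hq : 1 - p ≠ 0 := sub_ne_zero.2 hp.symm
  obtain ⟨k, rfl⟩ := Nat.exists_eq_add_of_le hj
  unfold binomialMass
  rw [Nat.add_sub_cancel_left, div_pow, pow_add]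
  field_simp

lemma sum_range_mul_choose {p : ℝ} (hp : p ≠ 1) {M N : ℕ} (hM : M ≤ N) (f : ℕ → ℝ) :
    ∑ j ∈ range M, f j * (N.choose j) * (p / (1 - p)) ^ j
      = ((1 - p) ^ N)⁻¹ * ∑ j ∈ range (N + 1), (if j < M then f j else 0) * binomialMass p N j := by
  have hS : range M = (range (N + 1)).filter (· < M) := by
    ext j; simp; omega
  rw [hS, sum_filter, mul_sum]
  refine sum_congr rfl fun j hj => ?_
  split_ifs
  · rw [mul_assoc, pow_mul_div_pow hp (by simpa [Nat.lt_succ_iff] using hj)]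
    ring
  · simp

lemma sum_Icc_mul_choose {p : ℝ} (hp0 : p ≠ 0) (hp : p ≠ 1) (M N : ℕ) (f : ℕ → ℝ) :
    ∑ j ∈ Icc M N, f j * (N.choose j) * (p / (1 - p)) ^ (j - M)
      = ((p / (1 - p)) ^ M)⁻¹ * ((1 - p) ^ N)⁻¹ *
        ∑ j ∈ range (N + 1), (if M ≤ j then f j else 0) * binomialMass p N j := by
  have hq : 1 - p ≠ 0 := sub_ne_zero.2 hp.symm
  have hS : Icc M N = (range (N + 1)).filter (M ≤ ·) := by
    ext j; simp; omega
  rw [hS, sum_filter, mul_sum]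
  refine sum_congr rfl fun j hj => ?_
  split_ifs with h
  · rw [pow_sub₀ _ (div_ne_zero hp0 hq) h]
    have := pow_mul_div_pow hp (show j ≤ N by simpa [Nat.lt_succ_iff] using hj)
    linear_combination f j * ((p / (1 - p)) ^ M)⁻¹ * this
  · simp

/-- The speed as a quotient of two mixtures of truncated binomial averages. -/
lemma speed1_eq {p0 p1 : ℝ} (h0 : 0 < p0) (h01 : p0 < p1) (h1 : p1 < 1) {M N : ℕ} (hM : M ≤ N) :
    speed1 N M p0 p1 =
      ((1 - p1) * ∑ j ∈ range (N + 1),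
          (if j < M then 2 * ((j : ℝ) / N) + -1 else 0) * binomialMass p0 N j +
        (1 - p0) * ((p0 * (1 - p1)) / (p1 * (1 - p0))) ^ ((M : ℝ) - N * rstar p0 p1) *
          ∑ j ∈ range (N + 1),
            (if M ≤ j then 2 * ((j : ℝ) / N) + -1 else 0) * binomialMass p1 N j) /
      ((1 - p1) * ∑ j ∈ range (N + 1),
          (if j < M then 0 * ((j : ℝ) / N) + 1 else 0) * binomialMass p0 N j +
        (1 - p0) * ((p0 * (1 - p1)) / (p1 * (1 - p0))) ^ ((M : ℝ) - N * rstar p0 p1) *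
          ∑ j ∈ range (N + 1),
            (if M ≤ j then 0 * ((j : ℝ) / N) + 1 else 0) * binomialMass p1 N j) := by
  have hp1 : 0 < p1 := h0.trans h01
  have hq0 : 0 < 1 - p0 := by linarith
  have hq1 : 0 < 1 - p1 := by linarith
  have key : ∀ f : ℕ → ℝ,
      (1 / (1 - p0)) * ∑ j ∈ range M, f j * (N.choose j) * (p0 / (1 - p0)) ^ j
        + (1 / (1 - p1)) * (p0 / (1 - p0)) ^ M *
          ∑ j ∈ Icc M N, f j * (N.choose j) * (p1 / (1 - p1)) ^ (j - M)
      = ((1 - p0) ^ N * (1 - p0) * (1 - p1))⁻¹ *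
        ((1 - p1) * ∑ j ∈ range (N + 1), (if j < M then f j else 0) * binomialMass p0 N j +
          (1 - p0) * ((p0 * (1 - p1)) / (p1 * (1 - p0))) ^ ((M : ℝ) - N * rstar p0 p1) *
            ∑ j ∈ range (N + 1), (if M ≤ j then f j else 0) * binomialMass p1 N j) := by
    intro f
    rw [sum_range_mul_choose (h01.trans h1).ne hM, sum_Icc_mul_choose hp1.ne' h1.ne,
      rpow_sub_mul_rstar h0 h01 h1]
    simp only [div_pow, mul_pow]
    field_simp
  have hnum := key fun j => 2 * ((j : ℝ) / N) + -1
  have hden := key fun j => 0 * ((j : ℝ) / N) + 1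
  rw [← mul_div_mul_left _ _ (show ((1 - p0) ^ N * (1 - p0) * (1 - p1))⁻¹ ≠ 0 by positivity),
    ← hnum, ← hden]
  simp only [speed1, zero_mul, zero_add, one_mul, mul_div_assoc, sub_eq_add_neg]

/-- Theorem 1.2 (critical case): if `M_N / N → r*(p₀,p₁)` and
`((p₀(1-p₁))/(p₁(1-p₀)))^(M_N - N·r*) → α ∈ [0,∞]`, then the speed converges to
`((2p₀-1)(1-p₁) + (2p₁-1)(1-p₀)α) / ((1-p₁) + (1-p₀)α)`, interpreted as
`2p₁ - 1` when `α = ∞`. -/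
theorem limit_speed_critical (p0 p1 : ℝ)
    (h0 : 0 < p0) (h01 : p0 < p1) (h1 : p1 < 1)
    (M : ℕ → ℕ) (hM : ∀ N, 1 ≤ N → 1 ≤ M N ∧ M N ≤ N)
    (hr : Tendsto (fun N => (M N : ℝ) / N) atTop (𝓝 (rstar p0 p1)))
    (α : ℝ≥0∞)
    (hα : Tendsto (fun N => ENNReal.ofReal
        (((p0 * (1 - p1)) / (p1 * (1 - p0))) ^ ((M N : ℝ) - N * rstar p0 p1)))
      atTop (𝓝 α)) :
    Tendsto (fun N => speed1 N (M N) p0 p1) atTop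
      (𝓝 (if α = ∞ then 2 * p1 - 1 else
        ((2 * p0 - 1) * (1 - p1) + (2 * p1 - 1) * (1 - p0) * α.toReal) /
          ((1 - p1) + (1 - p0) * α.toReal))) := by
  obtain ⟨hr0, hr1⟩ := rstar_mem_Ioo h0 h01 h1
  have hp1 : 0 < p1 := h0.trans h01
  have hp0' : p0 < 1 := h01.trans h1
  have hq0 : 0 < 1 - p0 := by linarith
  have hq1 : 0 < 1 - p1 := by linarith
  set r := rstar p0 p1 with hrdef
  have hlow : ∀ᶠ N : ℕ in atTop, ∀ j, ¬ j < M N → (r - p0) / 2 ≤ |(j : ℝ) / N - p0| := by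
    filter_upwards [hr.eventually_const_lt (show (r + p0) / 2 < r by linarith)] with N hN j hj
    have : (M N : ℝ) / N ≤ j / N := by
      gcongr
      exact not_lt.1 hj
    exact le_trans (by linarith) (le_abs_self _)
  have hupp : ∀ᶠ N : ℕ in atTop, ∀ j, ¬ M N ≤ j → (p1 - r) / 2 ≤ |(j : ℝ) / N - p1| := by
    filter_upwards [hr.eventually_lt_const (show r < (r + p1) / 2 by linarith)] with N hN j hj
    have : (j : ℝ) / N ≤ M N / N := by
      gcongr
      exact (not_le.1 hj).le
    exact le_trans (by linarith) (neg_le_abs _)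
  have low := fun c d => tendsto_sum_ite_mul_binomialMass h0.le hp0'.le
    (fun N j => j < M N) c d (show 0 < (r - p0) / 2 by linarith) hlow
  have upp := fun c d => tendsto_sum_ite_mul_binomialMass hp1.le h1.le
    (fun N j => M N ≤ j) c d (show 0 < (p1 - r) / 2 by linarith) hupp
  have lowN := (low (-1) 2).const_mul (1 - p1)
  have lowD := (low 1 0).const_mul (1 - p1)
  have hθ : 0 < (p0 * (1 - p1)) / (p1 * (1 - p0)) := by positivity
  have hspeed : ∀ᶠ N in atTop, _ = speed1 N (M N) p0 p1 :=
    (eventually_ge_atTop 1).mono fun N hN => (speed1_eq h0 h01 h1 (hM N hN).2).symm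
  refine Tendsto.congr' hspeed ?_
  rw [← hrdef]
  split_ifs with hα'
  · subst hα'
    have ht : Tendsto (fun N =>
        ((p0 * (1 - p1)) / (p1 * (1 - p0))) ^ ((M N : ℝ) - N * r)) atTop atTop :=
      ENNReal.tendsto_ofReal_nhds_top.1 hα
    have hti := ht.inv_tendsto_atTop
    have hlim := ((hti.mul lowN).add ((upp (-1) 2).const_mul (1 - p0))).div
      ((hti.mul lowD).add ((upp 1 0).const_mul (1 - p0))) (by simp [hq0.ne'])
    have hval : (0 * ((1 - p1) * (2 * p0 + -1)) + (1 - p0) * (2 * p1 + -1)) /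
        (0 * ((1 - p1) * (0 * p0 + 1)) + (1 - p0) * (0 * p1 + 1)) = 2 * p1 - 1 := by
      field_simp
      ring
    rw [hval] at hlim
    refine hlim.congr fun N => ?_
    have hpos : 0 < ((p0 * (1 - p1)) / (p1 * (1 - p0))) ^ ((M N : ℝ) - N * r) :=
      Real.rpow_pos_of_pos hθ _
    simp only [Pi.div_apply, Pi.inv_apply]
    rw [← mul_div_mul_left _ _ hpos.ne']
    congr 1 <;> (rw [mul_add, mul_inv_cancel_left₀ hpos.ne']; ring)
  · have ht : Tendsto (fun N =>
        ((p0 * (1 - p1)) / (p1 * (1 - p0))) ^ ((M N : ℝ) - N * r)) atTop (𝓝 α.toReal) :=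
      ((ENNReal.tendsto_toReal hα').comp hα).congr fun N =>
        ENNReal.toReal_ofReal (Real.rpow_pos_of_pos hθ _).le
    have hα0 : 0 ≤ α.toReal := ENNReal.toReal_nonneg
    have htq := ht.const_mul (1 - p0)
    have hlim := (lowN.add (htq.mul (upp (-1) 2))).div (lowD.add (htq.mul (upp 1 0))) (by
      simp only [zero_mul, zero_add, mul_one]
      positivity)
    convert hlim using 2
    · rfl
    · congr 1 <;> ring
end

section
/- For the random walk excited by its recent history with history window N and l threshold stages (M_1,p_1),…,(M_l,p_l) above the pre-threshold level p_0, the almost sure limit s(N,M_1,…,M_l;p_0,…,p_l) := lim_{n→∞} X_n/n exists and equals [ Σ_{i=0}^{l} (1/(1−p_i)) ( ∏_{k=1}^{i} (p_{k−1}/(1−p_{k−1}))^{M_k − M_{k−1}} ) Σ_{j=M_i}^{M_{i+1}−1} (2j/N − 1) C(N,j) (p_i/(1−p_i))^{j−M_i} ] / [ Σ_{i=0}^{l} (1/(1−p_i)) ( ∏_{k=1}^{i} (p_{k−1}/(1−p_{k−1}))^{M_k − M_{k−1}} ) Σ_{j=M_i}^{M_{i+1}−1} C(N,j) (p_i/(1−p_i))^{j−M_i}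 ], where M_0 = 0 and M_{l+1} = N + 1. -/
open Filter Finset MeasureTheory Topology

/-- The index `i` of the threshold stage corresponding to `c` right-jumps among the
`N` most recent jumps: the largest `i ∈ {0,…,l}` with `M i ≤ c` (so that, when
`M` is increasing with `M 0 = 0`, it is the unique `i` with `M i ≤ c < M (i+1)`). -/
def stage (l : ℕ) (M : ℕ → ℕ) (c : ℕ) : ℕ :=
  ((Finset.range (l + 1)).filter (fun i => M i ≤ c)).sup id

/-- The probability that the `n`-th increment of the multi-stage random walk excited
by its recent history agrees with `e n`, given that the previous increments agree
with `e`.  Here `e k = true` encodes a jump `+1` at time `k`. -/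
noncomputable def stepProbMulti (N l : ℕ) (M : ℕ → ℕ) (p : ℕ → ℝ)
    (e : ℕ → Bool) (n : ℕ) : ℝ :=
  let q : ℝ :=
    if n < N then p 0
    else p (stage l M (((Finset.Ico (n - N) n).filter (fun k => e k = true)).card))
  if e n then q else 1 - q

/-- The position after `n` steps of the walk whose increments are encoded by
`ω : ℕ → Bool` (`true` = `+1`, `false` = `-1`), started at `0`. -/
def walkPos (ω : ℕ → Bool) (n : ℕ) : ℤ :=
  ∑ k ∈ Finset.range n, (if ω k then 1 else -1)

/-- The explicit multi-stage speed formula `s(N,M₁,…,M_l;p₀,…,p_l)`. -/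
noncomputable def speedMulti (N l : ℕ) (M : ℕ → ℕ) (p : ℕ → ℝ) : ℝ :=
  (∑ i ∈ Finset.range (l + 1), (1 / (1 - p i)) *
      (∏ k ∈ Finset.Icc 1 i, (p (k - 1) / (1 - p (k - 1))) ^ (M k - M (k - 1))) *
      ∑ j ∈ Finset.Ico (M i) (M (i + 1)),
        (2 * (j : ℝ) / N - 1) * (N.choose j) * (p i / (1 - p i)) ^ (j - M i)) /
  (∑ i ∈ Finset.range (l + 1), (1 / (1 - p i)) *
      (∏ k ∈ Finset.Icc 1 i, (p (k - 1) / (1 - p (k - 1))) ^ (M k - M (k - 1))) *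
      ∑ j ∈ Finset.Ico (M i) (M (i + 1)),
        ((N.choose j : ℝ)) * (p i / (1 - p i)) ^ (j - M i))


/-- The number of `true` entries of a finite word. -/
def trueCount {n : ℕ} (x : Fin n → Bool) : ℕ := ∑ i, (x i).toNat

/-- Drop the first letter of a word and append `b` at its end. -/
def pushBit {m : ℕ} (x : Fin (m + 1) → Bool) (b : Bool) : Fin (m + 1) → Bool :=
  fun i => if h : (i : ℕ) + 1 < m + 1 then x ⟨i + 1, h⟩ else b

lemma trueCount_cons {n : ℕ} (a : Bool) (y : Fin n → Bool) :
    trueCount (Fin.cons a y : Fin (n + 1) → Bool) = a.toNat + trueCount y := by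
  simp [trueCount, Fin.sum_univ_succ]

lemma trueCount_snoc {n : ℕ} (y : Fin n → Bool) (b : Bool) :
    trueCount (Fin.snoc y b : Fin (n + 1) → Bool) = trueCount y + b.toNat := by
  simp [trueCount, Fin.sum_univ_castSucc]

lemma pushBit_cons {m : ℕ} (a : Bool) (y : Fin m → Bool) (b : Bool) :
    pushBit (Fin.cons a y : Fin (m + 1) → Bool) b = (Fin.snoc y b : Fin (m + 1) → Bool) := by
  funext i
  refine Fin.lastCases ?_ (fun j => ?_) i
  · simp [pushBit]
  · rw [pushBit, dif_pos (by simp), Fin.snoc_castSucc]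
    exact Fin.cons_succ (α := fun _ => Bool) a y j

lemma sum_word_cons {n : ℕ} (F : (Fin (n + 1) → Bool) → ℝ) :
    ∑ x, F x = ∑ y : Fin n → Bool, (F (Fin.cons true y) + F (Fin.cons false y)) := by
  rw [← (Fin.consEquiv (fun _ => Bool)).sum_comp, Fintype.sum_prod_type_right]
  simp [Fin.consEquiv]

lemma sum_word_snoc {n : ℕ} (F : (Fin (n + 1) → Bool) → ℝ) :
    ∑ x, F x = ∑ y : Fin n → Bool,
      (F (Fin.snoc y true : Fin (n + 1) → Bool) + F (Fin.snoc y false : Fin (n + 1) → Bool)) := by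
  rw [← (Fin.snocEquiv (fun _ => Bool)).sum_comp, Fintype.sum_prod_type_right]
  simp [Fin.snocEquiv]

lemma sum_apply_trueCount {n : ℕ} (F : ℕ → ℝ) :
    ∑ x : Fin n → Bool, F (trueCount x) = ∑ j ∈ range (n + 1), (n.choose j : ℝ) * F j := by
  have h := Finset.sum_powerset_apply_card F (x := (univ : Finset (Fin n)))
  simp only [Finset.powerset_univ, Finset.card_univ, Fintype.card_fin, nsmul_eq_mul] at h
  rw [← h]
  refine Finset.sum_nbij' (fun x => univ.filter (fun i => x i = true))
    (fun s i => decide (i ∈ s)) ?_ ?_ ?_ ?_ ?_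
  · simp
  · simp
  · intro x _; funext i; simp
  · intro s _; ext i; simp
  · intro x _
    congr 1
    rw [trueCount, Finset.card_filter]
    refine Finset.sum_congr rfl fun i _ => ?_
    cases x i <;> simp

/-- Averaging over the next letter, which is `true` with probability `q (trueCount x)`. -/
noncomputable def transition {m : ℕ} (q : ℕ → ℝ) :
    ((Fin (m + 1) → Bool) → ℝ) →ₗ[ℝ] ((Fin (m + 1) → Bool) → ℝ) where
  toFun g x := q (trueCount x) * g (pushBit x true) + (1 - q (trueCount x)) * g (pushBit x false)
  map_add' g h := by funext x; simp; ring
  map_smul' c g := by funext x; simp; ring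

lemma transition_apply {m : ℕ} (q : ℕ → ℝ) (g : (Fin (m + 1) → Bool) → ℝ)
    (x : Fin (m + 1) → Bool) :
    transition q g x = q (trueCount x) * g (pushBit x true) +
      (1 - q (trueCount x)) * g (pushBit x false) := rfl

/-- The unnormalised stationary weight of a word with `j` letters `true`. -/
noncomputable def stationaryWeight (q : ℕ → ℝ) (j : ℕ) : ℝ :=
  1 / (1 - q j) * ∏ k ∈ range j, q k / (1 - q k)

lemma stationaryWeight_pos {q : ℕ → ℝ} (hq : ∀ c, q c ∈ Set.Ioo 0 1) (j : ℕ) :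
    0 < stationaryWeight q j := by
  have h : ∀ c, 0 < 1 - q c := fun c => sub_pos.2 (hq c).2
  exact mul_pos (one_div_pos.2 (h j)) (Finset.prod_pos fun k _ => div_pos (hq k).1 (h k))

lemma stationaryWeight_succ {q : ℕ → ℝ} (hq : ∀ c, q c ∈ Set.Ioo 0 1) (j : ℕ) :
    stationaryWeight q (j + 1) * (1 - q (j + 1)) = stationaryWeight q j * q j := by
  have h : ∀ c, 1 - q c ≠ 0 := fun c => (sub_pos.2 (hq c).2).ne'
  have h1 := h j
  have h2 := h (j + 1)
  rw [stationaryWeight, stationaryWeight, Finset.prod_range_succ]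
  field_simp

lemma sum_stationaryWeight_mul_transition {m : ℕ} {q : ℕ → ℝ} (hq : ∀ c, q c ∈ Set.Ioo 0 1)
    (g : (Fin (m + 1) → Bool) → ℝ) :
    ∑ x, stationaryWeight q (trueCount x) * transition q g x =
      ∑ x, stationaryWeight q (trueCount x) * g x := by
  rw [sum_word_cons, sum_word_snoc]
  refine Finset.sum_congr rfl fun y _ => ?_
  have h := stationaryWeight_succ hq (trueCount y)
  simp only [transition_apply, pushBit_cons, trueCount_cons, trueCount_snoc, Bool.toNat_true,
    Bool.toNat_false, zero_add, add_zero, add_comm 1]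
  linear_combination (g (Fin.snoc y false : Fin (m + 1) → Bool) -
    g (Fin.snoc y true : Fin (m + 1) → Bool)) * h

lemma pushBit_true_iterate {m : ℕ} (x : Fin (m + 1) → Bool) (k : ℕ) (i : Fin (m + 1))
    (h : m + 1 ≤ i + k) : ((fun y => pushBit y true)^[k] x) i = true := by
  induction k generalizing i with
  | zero => omega
  | succ k ih =>
    rw [Function.iterate_succ_apply']
    simp only [pushBit]
    split_ifs with h'
    · exact ih _ (by simp; omega)
    · rfl

lemma le_apply_true_of_transition_eq {m : ℕ} {q : ℕ → ℝ} (hq : ∀ c, q c ∈ Set.Ioo 0 1)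
    {g : (Fin (m + 1) → Bool) → ℝ} (hg : transition q g = g) (y : Fin (m + 1) → Bool) :
    g y ≤ g (fun _ => true) := by
  obtain ⟨x, hx⟩ := Finite.exists_max g
  have key : ∀ k, ∀ z, g z ≤ g ((fun y => pushBit y true)^[k] x) := by
    intro k
    induction k with
    | zero => exact hx
    | succ k ih =>
      intro z
      rw [Function.iterate_succ_apply']
      set w := (fun y => pushBit y true)^[k] x
      have h := congrFun hg w
      rw [transition_apply] at h
      have h1 := ih (pushBit w false)
      have h2 := hq (trueCount w)
      have h3 : g w ≤ g (pushBit w true) := by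
        have := mul_le_mul_of_nonneg_left h1 (sub_pos.2 h2.2).le
        exact le_of_mul_le_mul_left (by linarith) h2.1
      exact (ih z).trans h3
  have hk : (fun y => pushBit y true)^[m + 1] x = fun _ => true :=
    funext fun i => pushBit_true_iterate x _ i (by omega)
  exact hk ▸ key (m + 1) y

/-- Functions fixed by `transition q` are constant. -/
lemma eq_apply_true_of_transition_eq {m : ℕ} {q : ℕ → ℝ} (hq : ∀ c, q c ∈ Set.Ioo 0 1)
    {g : (Fin (m + 1) → Bool) → ℝ} (hg : transition q g = g) (y : Fin (m + 1) → Bool) :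
    g y = g (fun _ => true) := by
  refine (le_apply_true_of_transition_eq hq hg y).antisymm ?_
  have := le_apply_true_of_transition_eq hq (g := -g) (by rw [map_neg, hg]) y
  simpa using this

/-- Solvability of the Poisson equation for the chain of words. -/
lemma exists_sub_transition_eq {m : ℕ} {q : ℕ → ℝ} (hq : ∀ c, q c ∈ Set.Ioo 0 1)
    (f : (Fin (m + 1) → Bool) → ℝ) :
    ∃ g : (Fin (m + 1) → Bool) → ℝ, ∀ x, g x - transition q g x =
      f x - (∑ y, stationaryWeight q (trueCount y) * f y) /
        ∑ y : Fin (m + 1) → Bool, stationaryWeight q (trueCount y) := by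
  set Z := ∑ y : Fin (m + 1) → Bool, stationaryWeight q (trueCount y) with hZ
  have hZpos : 0 < Z := Finset.sum_pos (fun y _ => stationaryWeight_pos hq _) univ_nonempty
  let ave : ((Fin (m + 1) → Bool) → ℝ) →ₗ[ℝ] ℝ :=
    Fintype.linearCombination ℝ fun y => stationaryWeight q (trueCount y)
  have ave_apply (g) : ave g = ∑ y, stationaryWeight q (trueCount y) * g y := by
    simp [ave, Fintype.linearCombination_apply, mul_comm]
  have ave_transition (g) : ave (transition q g) = ave g := by
    rw [ave_apply, ave_apply, sum_stationaryWeight_mul_transition hq]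
  have ave_one (c : ℝ) : ave (fun _ => c) = Z * c := by
    rw [ave_apply, ← Finset.sum_mul]
  let T : ((Fin (m + 1) → Bool) → ℝ) →ₗ[ℝ] ((Fin (m + 1) → Bool) → ℝ) :=
    LinearMap.id - transition q + LinearMap.pi fun _ => ave
  have hT (g) : T g = g - transition q g + fun _ => ave g := rfl
  have ave_T (g) : ave (T g) = Z * ave g := by
    rw [hT, map_add, map_sub, ave_transition, ave_one]; ring
  have hinj : Function.Injective T := by
    rw [injective_iff_map_eq_zero]
    intro g hg
    have h0 : ave g = 0 := by
      have := ave_T g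
      rw [hg, map_zero] at this
      simpa [hZpos.ne'] using this.symm
    have hfix : transition q g = g := by
      funext x
      have := congrFun hg x
      simp only [hT, h0, Pi.add_apply, Pi.sub_apply, Pi.zero_apply] at this
      linarith
    have hc : g = fun _ => g (fun _ => true) :=
      funext fun y => eq_apply_true_of_transition_eq hq hfix y
    rw [hc, ave_one] at h0
    rw [hc, (mul_eq_zero.1 h0).resolve_left hZpos.ne']
    rfl
  obtain ⟨g, hg⟩ := LinearMap.injective_iff_surjective.1 hinj f
  refine ⟨g, fun x => ?_⟩
  rw [← ave_apply, ← hg, ave_T, mul_div_cancel_left₀ _ hZpos.ne']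
  simp [hT]

/-- Under an exchangeable weight every letter has the same mean. -/
lemma sum_mul_letter_zero {m : ℕ} (w : ℕ → ℝ) :
    ∑ x : Fin (m + 1) → Bool, w (trueCount x) * (if x 0 then 1 else -1 : ℝ) =
      ∑ x : Fin (m + 1) → Bool,
        w (trueCount x) * (2 * (trueCount x : ℝ) / ((m + 1 : ℕ) : ℝ) - 1) := by
  have hsymm (i : Fin (m + 1)) :
      ∑ x : Fin (m + 1) → Bool, w (trueCount x) * (if x i then 1 else -1 : ℝ) =
        ∑ x : Fin (m + 1) → Bool, w (trueCount x) * (if x 0 then 1 else -1 : ℝ) := by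
    rw [← ((Equiv.swap 0 i).arrowCongr (Equiv.refl Bool)).sum_comp]
    refine Finset.sum_congr rfl fun x _ => ?_
    have : trueCount ((Equiv.swap 0 i).arrowCongr (Equiv.refl Bool) x) = trueCount x :=
      Equiv.sum_comp (Equiv.swap 0 i) fun j => (x j).toNat
    rw [this]
    simp
  have hN : ((m + 1 : ℕ) : ℝ) ≠ 0 := by positivity
  have hx (x : Fin (m + 1) → Bool) : w (trueCount x) * (2 * (trueCount x : ℝ) /
      ((m + 1 : ℕ) : ℝ) - 1) = (∑ i, w (trueCount x) * (if x i then 1 else -1 : ℝ)) /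
        ((m + 1 : ℕ) : ℝ) := by
    have : ∑ i, (if x i then 1 else -1 : ℝ) = ∑ i, (2 * ((x i).toNat : ℝ) - 1) :=
      Finset.sum_congr rfl fun i _ => by cases x i <;> norm_num
    have hc : (trueCount x : ℝ) = ∑ i, ((x i).toNat : ℝ) := by simp [trueCount]
    rw [← Finset.mul_sum, this, Finset.sum_sub_distrib, ← Finset.mul_sum, ← hc, Finset.sum_const,
      Finset.card_univ, Fintype.card_fin, nsmul_eq_mul]
    field_simp
  simp_rw [hx]
  rw [← Finset.sum_div, Finset.sum_comm]
  simp_rw [hsymm]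
  rw [Finset.sum_const, Finset.card_univ, Fintype.card_fin, nsmul_eq_mul,
    mul_div_cancel_left₀ _ hN]

/-- Strong law of large numbers for bounded random variables, each of which is orthogonal to the
sum of the previous ones. -/
lemma ae_tendsto_sum_div_of_integral_sum_mul_eq_zero {Ω : Type*} [MeasurableSpace Ω]
    (μ : Measure Ω) [IsProbabilityMeasure μ] (D : ℕ → Ω → ℝ) (C : ℝ)
    (hD : ∀ n, Measurable (D n)) (hC : ∀ n ω, |D n ω| ≤ C)
    (horth : ∀ n, ∫ ω, (∑ i ∈ range n, D i ω) * D n ω ∂μ = 0) :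
    ∀ᵐ ω ∂μ, Tendsto (fun n : ℕ => (∑ i ∈ range n, D i ω) / n) atTop (𝓝 0) := by
  set S : ℕ → Ω → ℝ := fun n ω => ∑ i ∈ range n, D i ω with hS
  have hSm (n) : Measurable (S n) := Finset.measurable_sum _ fun i _ => hD i
  have hSb (n ω) : |S n ω| ≤ n * C := by
    refine (Finset.abs_sum_le_sum_abs _ _).trans ?_
    simpa using Finset.sum_le_sum (s := range n) fun i _ => hC i ω
  have hint {F : Ω → ℝ} (hF : Measurable F) (B : ℝ) (hB : ∀ ω, |F ω| ≤ B) : Integrable F μ :=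
    Integrable.of_bound hF.aestronglyMeasurable B (ae_of_all _ hB)
  have hC0 : 0 ≤ C := by
    obtain ⟨ω⟩ := μ.nonempty_of_neZero
    exact (abs_nonneg _).trans (hC 0 ω)
  have hS2int (n) : Integrable (fun ω => S n ω ^ 2) μ :=
    hint ((hSm n).pow_const 2) ((n * C) ^ 2) fun ω => by
      rw [abs_pow]; exact pow_le_pow_left₀ (abs_nonneg _) (hSb n ω) 2
  have hD2int (n) : Integrable (fun ω => D n ω ^ 2) μ :=
    hint ((hD n).pow_const 2) (C ^ 2) fun ω => by
      rw [abs_pow]; exact pow_le_pow_left₀ (abs_nonneg _) (hC n ω) 2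
  have hSDint (n) : Integrable (fun ω => S n ω * D n ω) μ :=
    hint ((hSm n).mul (hD n)) ((n * C) * C) fun ω => by
      rw [abs_mul]; exact mul_le_mul (hSb n ω) (hC n ω) (abs_nonneg _) (by positivity)
  have hvar (n) : ∫ ω, S n ω ^ 2 ∂μ ≤ n * C ^ 2 := by
    induction n with
    | zero => simp [hS]
    | succ n ih =>
      have h1 : ∀ ω, S (n + 1) ω ^ 2 = S n ω ^ 2 + 2 * (S n ω * D n ω) + D n ω ^ 2 := fun ω => by
        simp only [hS, Finset.sum_range_succ]; ring
      have h2 : ∫ ω, D n ω ^ 2 ∂μ ≤ C ^ 2 := by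
        refine (integral_mono (hD2int n) (integrable_const (C ^ 2)) fun ω => ?_).trans_eq (by simp)
        exact sq_le_sq' (abs_le.1 (hC n ω)).1 (abs_le.1 (hC n ω)).2
      simp_rw [h1]
      have h3 : Integrable (fun ω => S n ω ^ 2 + 2 * (S n ω * D n ω)) μ :=
        (hS2int n).add ((hSDint n).const_mul 2)
      rw [integral_add h3 (hD2int n), integral_add (hS2int n) ((hSDint n).const_mul 2), integral_const_mul, horth n]
      push_cast
      linarith
  have hsq : ∀ᵐ ω ∂μ, Tendsto (fun n : ℕ => S (n ^ 2) ω / (n : ℝ) ^ 2) atTop (𝓝 0) := by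
    have hterm (n : ℕ) : ∫⁻ ω, ENNReal.ofReal ((S (n ^ 2) ω / (n : ℝ) ^ 2) ^ 2) ∂μ ≤
        ENNReal.ofReal (C ^ 2 * (1 / (n : ℝ) ^ 2)) := by
      have hi : Integrable (fun ω => (S (n ^ 2) ω / (n : ℝ) ^ 2) ^ 2) μ := by
        simp_rw [div_pow]
        exact (hS2int _).div_const _
      rw [← ofReal_integral_eq_lintegral_ofReal hi (ae_of_all _ fun ω => sq_nonneg _)]
      refine ENNReal.ofReal_le_ofReal ?_
      simp_rw [div_pow]
      rw [integral_div]
      rcases Nat.eq_zero_or_pos n with rfl | hn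
      · simp
      · have hn' : (0 : ℝ) < n := by exact_mod_cast hn
        have := hvar (n ^ 2)
        push_cast at this
        rw [div_le_iff₀ (by positivity)]
        calc _ ≤ _ := this
          _ = _ := by field_simp
    have hsum : ∑' n : ℕ, ∫⁻ ω, ENNReal.ofReal ((S (n ^ 2) ω / (n : ℝ) ^ 2) ^ 2) ∂μ ≠ ⊤ := by
      have hs : Summable fun n : ℕ => C ^ 2 * (1 / (n : ℝ) ^ 2) :=
        (Real.summable_one_div_nat_pow.2 one_lt_two).mul_left _
      exact ne_top_of_le_ne_top hs.tsum_ofReal_ne_top (ENNReal.tsum_le_tsum hterm)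
    have hm (n : ℕ) : Measurable fun ω => ENNReal.ofReal ((S (n ^ 2) ω / (n : ℝ) ^ 2) ^ 2) :=
      (((hSm _).div_const _).pow_const 2).ennreal_ofReal
    rw [← lintegral_tsum fun n => (hm n).aemeasurable] at hsum
    filter_upwards [ae_lt_top (Measurable.tsum hm) hsum] with ω hω
    have h0 := ENNReal.tendsto_atTop_zero_of_tsum_ne_top hω.ne
    have h1 := (ENNReal.tendsto_toReal ENNReal.zero_ne_top).comp h0
    have h2 : Tendsto (fun n : ℕ => (S (n ^ 2) ω / (n : ℝ) ^ 2) ^ 2) atTop (𝓝 0) := by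
      refine h1.congr fun n => ?_
      simp [ENNReal.toReal_ofReal (sq_nonneg _)]
    have h3 := h2.sqrt
    simp_rw [Real.sqrt_sq_eq_abs, Real.sqrt_zero] at h3
    exact (tendsto_zero_iff_abs_tendsto_zero _).2 h3
  filter_upwards [hsq] with ω hω
  have hsqrt : Tendsto Nat.sqrt atTop atTop :=
    tendsto_atTop_mono' atTop (f₁ := fun n => n.sqrt) (by rfl) <|
      tendsto_atTop.2 fun b => (eventually_ge_atTop (b ^ 2)).mono fun n hn => Nat.le_sqrt'.2 hn
  have hbound : Tendsto (fun m : ℕ => |S (m ^ 2) ω / (m : ℝ) ^ 2| + 2 * C * (m : ℝ)⁻¹) atTop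
      (𝓝 0) := by
    simpa using hω.abs.add (tendsto_inv_atTop_nhds_zero_nat.const_mul (2 * C))
  refine squeeze_zero_norm' ?_ (hbound.comp hsqrt)
  filter_upwards [eventually_ge_atTop 1] with n hn
  set m := n.sqrt with hmdef
  have hm0 : 0 < m := Nat.sqrt_pos.2 hn
  have hmn : m ^ 2 ≤ n := Nat.sqrt_le' n
  have hnm : n ≤ m ^ 2 + 2 * m := by
    have := Nat.sqrt_le_add n
    rw [sq, hmdef]; omega
  have hdiff : |S n ω - S (m ^ 2) ω| ≤ 2 * m * C := by
    have : S n ω - S (m ^ 2) ω = ∑ i ∈ Finset.Ico (m ^ 2) n, D i ω := by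
      rw [Finset.sum_Ico_eq_sub _ hmn]
    rw [this]
    refine (Finset.abs_sum_le_sum_abs _ _).trans ((Finset.sum_le_sum fun i _ => hC i ω).trans ?_)
    rw [Finset.sum_const, Nat.card_Ico, nsmul_eq_mul]
    refine mul_le_mul_of_nonneg_right ?_ hC0
    exact_mod_cast (by omega : n - m ^ 2 ≤ 2 * m)
  have hm' : (0 : ℝ) < m := by exact_mod_cast hm0
  have hmn' : (m : ℝ) ^ 2 ≤ n := by exact_mod_cast hmn
  rw [Real.norm_eq_abs, abs_div, Nat.abs_cast]
  calc |S n ω| / n ≤ |S n ω| / (m : ℝ) ^ 2 := by gcongr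
    _ ≤ (|S (m ^ 2) ω| + 2 * m * C) / (m : ℝ) ^ 2 := by
      gcongr
      have := abs_sub_abs_le_abs_sub (S n ω) (S (m ^ 2) ω)
      linarith
    _ = _ := by
      simp only [Function.comp_apply, abs_div, abs_pow, Nat.abs_cast, ← hmdef]
      field_simp

/-- The infinite word extending `x` by `false`. -/
def extendWord {n : ℕ} (x : Fin n → Bool) (k : ℕ) : Bool := if h : k < n then x ⟨k, h⟩ else false

/-- The first `n` letters of an infinite word. -/
def initialWord (n : ℕ) (ω : ℕ → Bool) (i : Fin n) : Bool := ω i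

lemma measurable_initialWord (n : ℕ) : Measurable (initialWord n) :=
  measurable_pi_lambda _ fun i => measurable_pi_apply (i : ℕ)

lemma DependsOn.apply_extendWord_initialWord {n : ℕ} {F : (ℕ → Bool) → ℝ}
    (hF : DependsOn F (Set.Iio n)) (ω : ℕ → Bool) : F (extendWord (initialWord n ω)) = F ω :=
  hF fun k hk => by simp [extendWord, initialWord, Set.mem_Iio.1 hk]

lemma DependsOn.measurable_of_Iio {n : ℕ} {F : (ℕ → Bool) → ℝ}
    (hF : DependsOn F (Set.Iio n)) : Measurable F := by
  have : F = (fun x => F (extendWord x)) ∘ initialWord n :=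
    funext fun ω => (hF.apply_extendWord_initialWord ω).symm
  rw [this]
  exact (measurable_of_finite _).comp (measurable_initialWord n)

lemma extendWord_snoc {n : ℕ} (y : Fin n → Bool) (b : Bool) :
    extendWord (Fin.snoc y b : Fin (n + 1) → Bool) = Function.update (extendWord y) n b := by
  funext k
  rcases lt_trichotomy k n with h | rfl | h
  · rw [Function.update_of_ne h.ne, extendWord, extendWord, dif_pos h, dif_pos (by omega)]
    exact Fin.snoc_castSucc (α := fun _ => Bool) b y ⟨k, h⟩
  · rw [Function.update_self, extendWord, dif_pos (by omega)]
    exact Fin.snoc_last (α := fun _ => Bool) b y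
  · rw [Function.update_of_ne h.ne', extendWord, extendWord, dif_neg (by omega),
      dif_neg (by omega)]

section Predictable

variable (μ : Measure (ℕ → Bool)) [IsProbabilityMeasure μ] (r : ℕ → (ℕ → Bool) → ℝ)

lemma integral_eq_sum_extendWord (hr : ∀ n ω, r n ω ∈ Set.Icc 0 1)
    (hμ : ∀ (n : ℕ) (e : ℕ → Bool), μ {ω | ∀ k < n, ω k = e k} =
      ENNReal.ofReal (∏ k ∈ range n, if e k then r k e else 1 - r k e))
    {n : ℕ} {F : (ℕ → Bool) → ℝ} (hF : DependsOn F (Set.Iio n)) :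
    ∫ ω, F ω ∂μ = ∑ x : Fin n → Bool,
      (∏ k ∈ range n, if extendWord x k then r k (extendWord x) else 1 - r k (extendWord x)) *
        F (extendWord x) := by
  have h1 : ∫ ω, F ω ∂μ = ∫ ω, F (extendWord (initialWord n ω)) ∂μ :=
    integral_congr_ae (ae_of_all _ fun ω => (hF.apply_extendWord_initialWord ω).symm)
  have : IsProbabilityMeasure (μ.map (initialWord n)) :=
    Measure.isProbabilityMeasure_map (measurable_initialWord n).aemeasurable
  rw [h1, ← integral_map (f := fun x => F (extendWord x)) (measurable_initialWord n).aemeasurable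
    (measurable_of_finite _).aestronglyMeasurable, integral_fintype (Integrable.of_finite)]
  refine Finset.sum_congr rfl fun x _ => ?_
  have hset : initialWord n ⁻¹' {x} = {ω | ∀ k < n, ω k = extendWord x k} := by
    ext ω
    simp only [Set.mem_preimage, Set.mem_singleton_iff, Set.mem_ofPred_eq]
    refine ⟨fun h k hk => by simp [← h, extendWord, initialWord, hk], fun h => funext fun i => ?_⟩
    simpa [extendWord, initialWord] using h i i.2
  rw [measureReal_def, Measure.map_apply (measurable_initialWord n) (measurableSet_singleton x),
    hset, hμ, ENNReal.toReal_ofReal, smul_eq_mul]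
  refine Finset.prod_nonneg fun k _ => ?_
  have := hr k (extendWord x)
  split_ifs
  exacts [this.1, sub_nonneg.2 this.2]

lemma integral_eq_zero_of_update (hr : ∀ n ω, r n ω ∈ Set.Icc 0 1)
    (hrdep : ∀ n, DependsOn (r n) (Set.Iio n))
    (hμ : ∀ (n : ℕ) (e : ℕ → Bool), μ {ω | ∀ k < n, ω k = e k} =
      ENNReal.ofReal (∏ k ∈ range n, if e k then r k e else 1 - r k e))
    {n : ℕ} {F : (ℕ → Bool) → ℝ} (hF : DependsOn F (Set.Iio (n + 1)))
    (hzero : ∀ ω, r n ω * F (Function.update ω n true) +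
      (1 - r n ω) * F (Function.update ω n false) = 0) :
    ∫ ω, F ω ∂μ = 0 := by
  rw [integral_eq_sum_extendWord μ r hr hμ hF, sum_word_snoc]
  refine Finset.sum_eq_zero fun y _ => ?_
  have hupd (k) (hk : k ≤ n) (b : Bool) :
      r k (Function.update (extendWord y) n b) = r k (extendWord y) :=
    hrdep k fun j hj => Function.update_of_ne (by have := Set.mem_Iio.1 hj; omega) _ _
  have hprod (b : Bool) : (∏ k ∈ range n, if Function.update (extendWord y) n b k then
      r k (Function.update (extendWord y) n b) else
        1 - r k (Function.update (extendWord y) n b)) =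
      ∏ k ∈ range n, if extendWord y k then r k (extendWord y) else 1 - r k (extendWord y) := by
    refine Finset.prod_congr rfl fun k hk => ?_
    have hk := Finset.mem_range.1 hk
    rw [hupd k hk.le, Function.update_of_ne hk.ne]
  have hz := hzero (extendWord y)
  simp only [extendWord_snoc, Finset.prod_range_succ, hprod,
    hupd n le_rfl, Function.update_self, if_true, Bool.false_eq_true, if_false]
  linear_combination (∏ k ∈ range n, if extendWord y k then r k (extendWord y) else
    1 - r k (extendWord y)) * hz

end Predictable

section Stages

variable {l : ℕ} {M : ℕ → ℕ}

lemma stage_le (l : ℕ) (M : ℕ → ℕ) (c : ℕ) : stage l M c ≤ l :=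
  Finset.sup_le fun i hi => by
    have := Finset.mem_range.1 (Finset.mem_filter.1 hi).1
    simp only [id]
    omega

lemma threshold_mono (hM : ∀ i ≤ l, M i < M (i + 1)) {i j : ℕ} (hij : i ≤ j) (hj : j ≤ l + 1) :
    M i ≤ M j := by
  induction j, hij using Nat.le_induction with
  | base => rfl
  | succ j _ ih => exact (ih (by omega)).trans (hM j (by omega)).le

lemma stage_eq (hM : ∀ i ≤ l, M i < M (i + 1)) {i c : ℕ} (hi : i ≤ l)
    (hc : c ∈ Finset.Ico (M i) (M (i + 1))) : stage l M c = i := by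
  rw [Finset.mem_Ico] at hc
  refine le_antisymm (Finset.sup_le fun j hj => ?_) ?_
  · simp only [Finset.mem_filter, Finset.mem_range] at hj
    by_contra! h
    have := threshold_mono hM (i := i + 1) (j := j) h (by omega)
    omega
  · exact Finset.le_sup (f := id) (by simp; omega)

lemma sum_range_threshold (hM : ∀ i ≤ l, M i < M (i + 1)) (hM0 : M 0 = 0) (F : ℕ → ℝ) {i : ℕ}
    (hi : i ≤ l + 1) :
    ∑ j ∈ range (M i), F j = ∑ k ∈ range i, ∑ j ∈ Finset.Ico (M k) (M (k + 1)), F j := by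
  induction i with
  | zero => simp [hM0]
  | succ i ih =>
    rw [Finset.sum_range_succ, ← ih (by omega),
      Finset.sum_range_add_sum_Ico F (hM i (by omega)).le]

lemma prod_range_threshold (hM : ∀ i ≤ l, M i < M (i + 1)) (hM0 : M 0 = 0) (φ : ℕ → ℝ) {i : ℕ}
    (hi : i ≤ l) :
    ∏ c ∈ range (M i), φ (stage l M c) =
      ∏ k ∈ Finset.Icc 1 i, φ (k - 1) ^ (M k - M (k - 1)) := by
  induction i with
  | zero => simp [hM0]
  | succ i ih =>
    rw [Finset.prod_Icc_succ_top (by omega), ← ih (by omega),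
      ← Finset.prod_range_mul_prod_Ico _ (hM i (by omega)).le, Finset.prod_congr (g := fun _ => φ i)
        (rfl : Finset.Ico (M i) (M (i + 1)) = _) fun c hc => by rw [stage_eq hM (by omega) hc]]
    simp

lemma stationaryWeight_stage (hM : ∀ i ≤ l, M i < M (i + 1)) (hM0 : M 0 = 0) (p : ℕ → ℝ)
    {i j : ℕ} (hi : i ≤ l) (hj : j ∈ Finset.Ico (M i) (M (i + 1))) :
    stationaryWeight (fun c => p (stage l M c)) j =
      1 / (1 - p i) * (∏ k ∈ Finset.Icc 1 i, (p (k - 1) / (1 - p (k - 1))) ^ (M k - M (k - 1))) *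
        (p i / (1 - p i)) ^ (j - M i) := by
  have hj' := Finset.mem_Ico.1 hj
  have hprod := prod_range_threshold hM hM0 (fun k => p k / (1 - p k)) hi
  rw [stationaryWeight, ← Finset.prod_range_mul_prod_Ico _ hj'.1, hprod,
    Finset.prod_congr (g := fun _ => p i / (1 - p i)) (rfl : Finset.Ico (M i) j = _) fun c hc => by
      rw [stage_eq hM hi (Finset.Ico_subset_Ico_right hj'.2.le hc)],
    stage_eq hM hi hj, Finset.prod_const, Nat.card_Ico, mul_assoc]

lemma sum_stationaryWeight_stage (hM : ∀ i ≤ l, M i < M (i + 1)) (hM0 : M 0 = 0)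
    {N : ℕ} (hMtop : M (l + 1) = N + 1) (p : ℕ → ℝ) (F : ℕ → ℝ) :
    ∑ x : Fin N → Bool, stationaryWeight (fun c => p (stage l M c)) (trueCount x) *
        F (trueCount x) =
      ∑ i ∈ range (l + 1), 1 / (1 - p i) *
        (∏ k ∈ Finset.Icc 1 i, (p (k - 1) / (1 - p (k - 1))) ^ (M k - M (k - 1))) *
        ∑ j ∈ Finset.Ico (M i) (M (i + 1)),
          F j * (N.choose j : ℝ) * (p i / (1 - p i)) ^ (j - M i) := by
  rw [sum_apply_trueCount (fun j => stationaryWeight (fun c => p (stage l M c)) j * F j),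
    ← hMtop, sum_range_threshold hM hM0 _ le_rfl]
  refine Finset.sum_congr rfl fun i hi => ?_
  rw [Finset.mul_sum]
  refine Finset.sum_congr rfl fun j hj => ?_
  rw [stationaryWeight_stage hM hM0 p (Nat.lt_succ_iff.1 (Finset.mem_range.1 hi)) hj]
  ring

lemma speedMulti_eq (hM : ∀ i ≤ l, M i < M (i + 1)) (hM0 : M 0 = 0)
    {m : ℕ} (hMtop : M (l + 1) = m + 1 + 1) (p : ℕ → ℝ) :
    speedMulti (m + 1) l M p =
      (∑ x : Fin (m + 1) → Bool, stationaryWeight (fun c => p (stage l M c)) (trueCount x) *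
        (if x 0 then 1 else -1 : ℝ)) /
      ∑ x : Fin (m + 1) → Bool, stationaryWeight (fun c => p (stage l M c)) (trueCount x) := by
  have h1 := sum_stationaryWeight_stage hM hM0 hMtop p
    (fun j => 2 * (j : ℝ) / ((m + 1 : ℕ) : ℝ) - 1)
  have h2 := sum_stationaryWeight_stage hM hM0 hMtop p (fun _ => 1)
  simp only [mul_one, one_mul] at h2
  rw [sum_mul_letter_zero, h1, h2, speedMulti]

end Stages

/-- The `m + 1` letters of an infinite word from position `n` on. -/
def window (m : ℕ) (ω : ℕ → Bool) (n : ℕ) (i : Fin (m + 1)) : Bool := ω (n + i)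

lemma window_succ (m : ℕ) (ω : ℕ → Bool) (n : ℕ) :
    window m ω (n + 1) = pushBit (window m ω n) (ω (n + (m + 1))) := by
  funext i
  simp only [window, pushBit]
  split_ifs with h
  · congr 1; omega
  · congr 1; omega

lemma window_congr {m n : ℕ} {ω ω' : ℕ → Bool} (h : ∀ k < n + (m + 1), ω k = ω' k) :
    window m ω n = window m ω' n :=
  funext fun i => h _ (by omega)

lemma trueCount_window (m : ℕ) (ω : ℕ → Bool) (n : ℕ) :
    trueCount (window m ω n) =
      ((Finset.Ico n (n + (m + 1))).filter (fun k => ω k = true)).card := by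
  rw [Finset.card_filter, Finset.sum_Ico_eq_sum_range, trueCount, add_tsub_cancel_left,
    ← Fin.sum_univ_eq_sum_range (fun k => if ω (n + k) = true then 1 else 0)]
  refine Finset.sum_congr rfl fun i _ => ?_
  simp only [window]
  cases ω (n + i) <;> rfl

/-- The conditional probability that the letter at time `n` is `true`, when the first `N` letters
have bias `a` and the later ones have bias `q c`, where `c` counts `true` among the last `N`. -/
noncomputable def historyBias (N : ℕ) (a : ℝ) (q : ℕ → ℝ) (n : ℕ) (ω : ℕ → Bool) : ℝ :=
  if n < N then a else q ((Finset.Ico (n - N) n).filter (fun k => ω k = true)).card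

lemma dependsOn_historyBias (N : ℕ) (a : ℝ) (q : ℕ → ℝ) (n : ℕ) :
    DependsOn (historyBias N a q n) (Set.Iio n) := by
  intro ω ω' h
  have : (Finset.Ico (n - N) n).filter (fun k => ω k = true) =
      (Finset.Ico (n - N) n).filter (fun k => ω' k = true) :=
    Finset.filter_congr fun k hk => by rw [h k (Finset.mem_Ico.1 hk).2]
  rw [historyBias, historyBias, this]

lemma historyBias_add (m : ℕ) (a : ℝ) (q : ℕ → ℝ) (n : ℕ) (ω : ℕ → Bool) :
    historyBias (m + 1) a q (n + (m + 1)) ω = q (trueCount (window m ω n)) := by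
  rw [historyBias, if_neg (by omega), trueCount_window, Nat.add_sub_cancel]

/-- Averages of a function of the window along the excited walk vanish when the function is
centred by its conditional expectation. -/
lemma ae_tendsto_sum_sub_transition_div {m : ℕ} {q : ℕ → ℝ} (hq : ∀ c, q c ∈ Set.Ioo 0 1)
    {a : ℝ} (ha : a ∈ Set.Ioo 0 1) (μ : Measure (ℕ → Bool)) [IsProbabilityMeasure μ]
    (hμ : ∀ (n : ℕ) (e : ℕ → Bool), μ {ω | ∀ k < n, ω k = e k} = ENNReal.ofReal
      (∏ k ∈ range n, if e k then historyBias (m + 1) a q k e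
        else 1 - historyBias (m + 1) a q k e))
    (g : (Fin (m + 1) → Bool) → ℝ) :
    ∀ᵐ ω ∂μ, Tendsto (fun n : ℕ => (∑ k ∈ range n,
      (g (window m ω (k + 1)) - transition q g (window m ω k))) / n) atTop (𝓝 0) := by
  obtain ⟨x, hx⟩ := Finite.exists_max fun x => |g x|
  obtain ⟨y, hy⟩ := Finite.exists_max fun x => |transition q g x|
  have hdep (k : ℕ) : DependsOn (fun ω => g (window m ω (k + 1)) - transition q g (window m ω k))
      (Set.Iio (k + (m + 1) + 1)) := fun ω ω' h => by
    dsimp only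
    rw [window_congr (n := k + 1) fun j hj => h j (by simp; omega),
      window_congr (n := k) fun j hj => h j (by simp; omega)]
  refine ae_tendsto_sum_div_of_integral_sum_mul_eq_zero μ
    (fun k ω => g (window m ω (k + 1)) - transition q g (window m ω k))
    (|g x| + |transition q g y|) (fun k => (hdep k).measurable_of_Iio)
    (fun k ω => (abs_sub _ _).trans (add_le_add (hx _) (hy _))) fun n => ?_
  have hbias (n ω) : historyBias (m + 1) a q n ω ∈ Set.Ioo (0 : ℝ) 1 := by
    rw [historyBias]
    split_ifs
    exacts [ha, hq _]
  have hsum {ω ω' : ℕ → Bool} (h : ∀ k < n + (m + 1), ω k = ω' k) :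
      ∑ k ∈ range n, (g (window m ω (k + 1)) - transition q g (window m ω k)) =
        ∑ k ∈ range n, (g (window m ω' (k + 1)) - transition q g (window m ω' k)) :=
    Finset.sum_congr rfl fun k hk => hdep k fun j hj => h j (by
      have := Finset.mem_range.1 hk
      have := Set.mem_Iio.1 hj
      omega)
  refine integral_eq_zero_of_update μ (historyBias (m + 1) a q)
    (fun n ω => Set.Ioo_subset_Icc_self (hbias n ω)) (dependsOn_historyBias _ _ _) hμ
    (n := n + (m + 1)) (fun ω ω' h => ?_) fun ω => ?_
  · have h' : ∀ k < n + (m + 1), ω k = ω' k := fun k hk => h k (by simp; omega)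
    exact congrArg₂ _ (hsum h') (hdep n h)
  · have hupd (b : Bool) : ∀ k < n + (m + 1), Function.update ω (n + (m + 1)) b k = ω k :=
      fun k hk => Function.update_of_ne hk.ne _ _
    have hw (b : Bool) : window m (Function.update ω (n + (m + 1)) b) n = window m ω n :=
      window_congr (hupd b)
    rw [hsum (hupd true), hsum (hupd false)]
    generalize ∑ k ∈ range n, (g (window m ω (k + 1)) - transition q g (window m ω k)) = S
    simp only [window_succ, hw, Function.update_self, historyBias_add]
    rw [transition_apply]
    ring

lemma walkPos_cast (m : ℕ) (ω : ℕ → Bool) (n : ℕ) :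
    (walkPos ω n : ℝ) = ∑ k ∈ range n, (if window m ω k 0 then 1 else -1 : ℝ) := by
  rw [walkPos]
  push_cast
  rfl

/-- Theorem 1.3: for the multi-stage random walk excited by its recent history with
history window `N ≥ l`, thresholds `1 ≤ M₁ < ⋯ < M_l ≤ N` (with `M₀ = 0`,
`M_{l+1} = N+1`) and `0 < p₀ < ⋯ < p_l < 1`, almost surely `X_n / n` converges,
and its limit is the explicit expression `speedMulti N l M p`. -/
theorem speed_of_multistage_excited_rw (l N : ℕ) (hl : 1 ≤ l) (hlN : l ≤ N)
    (M : ℕ → ℕ) (hM0 : M 0 = 0) (hM1 : 1 ≤ M 1)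
    (hMmono : ∀ i, 1 ≤ i → i < l → M i < M (i + 1)) (hMl : M l ≤ N)
    (hMtop : M (l + 1) = N + 1)
    (p : ℕ → ℝ) (hp0 : 0 < p 0) (hpmono : ∀ i < l, p i < p (i + 1)) (hpl : p l < 1)
    (μ : Measure (ℕ → Bool)) [IsProbabilityMeasure μ]
    (hμ : ∀ (n : ℕ) (e : ℕ → Bool),
      μ {ω | ∀ k < n, ω k = e k} =
        ENNReal.ofReal (∏ k ∈ Finset.range n, stepProbMulti N l M p e k)) :
    ∀ᵐ ω ∂μ, Tendsto (fun n => (walkPos ω n : ℝ) / n) atTop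
      (𝓝 (speedMulti N l M p)) := by
  obtain ⟨m, rfl⟩ : ∃ m, N = m + 1 := ⟨N - 1, by omega⟩
  have hM : ∀ i ≤ l, M i < M (i + 1) := by
    intro i hi
    rcases Nat.eq_zero_or_pos i with rfl | hi0
    · simp only [zero_add]; omega
    · rcases hi.lt_or_eq with h | rfl
      · exact hMmono i hi0 h
      · omega
  have hp_pos : ∀ i ≤ l, 0 < p i := by
    intro i
    induction i with
    | zero => exact fun _ => hp0
    | succ i ih => exact fun h => (ih (by omega)).trans (hpmono i h)
  have hp_lt : ∀ i ≤ l, p i < 1 := fun i hi => by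
    induction hi using Nat.decreasingInduction with
    | self => exact hpl
    | of_succ k hk ih => exact (hpmono k hk).trans ih
  set q : ℕ → ℝ := fun c => p (stage l M c)
  have hq : ∀ c, q c ∈ Set.Ioo 0 1 := fun c =>
    ⟨hp_pos _ (stage_le l M c), hp_lt _ (stage_le l M c)⟩
  obtain ⟨g, hg⟩ := exists_sub_transition_eq (m := m) hq fun x => if x 0 then 1 else -1
  rw [← speedMulti_eq hM hM0 hMtop p] at hg
  set s := speedMulti (m + 1) l M p
  obtain ⟨x, hx⟩ := Finite.exists_max fun x => |g x|
  filter_upwards [ae_tendsto_sum_sub_transition_div hq ⟨hp0, hp_lt 0 (Nat.zero_le l)⟩ μ hμ g]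
    with ω hω
  have hwalk (n : ℕ) : (walkPos ω n : ℝ) = n * s + (g (window m ω 0) - g (window m ω n)) +
      ∑ k ∈ range n, (g (window m ω (k + 1)) - transition q g (window m ω k)) := by
    rw [walkPos_cast m, ← Finset.sum_range_sub' (fun k => g (window m ω k)), add_assoc,
      ← Finset.sum_add_distrib]
    have hns : (n : ℝ) * s = ∑ k ∈ range n, s := by simp
    rw [hns, ← Finset.sum_add_distrib]
    refine Finset.sum_congr rfl fun k _ => ?_
    have := hg (window m ω k)
    linarith
  have hbdry : Tendsto (fun n : ℕ => (g (window m ω 0) - g (window m ω n)) / n) atTop (𝓝 0) := by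
    refine squeeze_zero_norm (a := fun n : ℕ => (|g x| + |g x|) / n) (fun n => ?_)
      (tendsto_const_div_atTop_nhds_zero_nat _)
    rw [Real.norm_eq_abs, abs_div, Nat.abs_cast]
    gcongr
    exact (abs_sub _ _).trans (add_le_add (hx _) (hx _))
  have hlim := (hbdry.const_add s).add hω
  simp only [add_zero] at hlim
  refine hlim.congr' ?_
  filter_upwards [eventually_ne_atTop 0] with n hn
  have hn' : (n : ℝ) ≠ 0 := by exact_mod_cast hn
  rw [hwalk]
  field_simp
end
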